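/- Consider the non-stationary AR(1) model with i.i.d. standard Gaussian noise and x₀ = 0, and fix δ_s ∈ (0,1). There exist constants C₃, C₄, C₅ > 0 depending only on δ_s such that for any two parameters β, β′ ∈ Θ_T, the Kullback–Leibler divergence between the corresponding joint laws of x_{1:T} satisfies KL(p_β ‖ p_{β′}) ≤ C₃·T + C₄·δ₀(T)·Σ_{t=2}^T s(t) + C₅·δ₀(T)²·Σ_{t=2}^T s(t)². In particular, for any ε-packing N = {β₁,…,β_N} ⊆ Θ_T, max_{i,j} KL(p_{β_i} ‖ p_{β_j}) is bounded by the same quantity. -/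

import Mathlib

open MeasureTheory ProbabilityTheory Finset ENNReal

/-- The AR(1) recursion `xᵢ = fᵢ + α·x_{i−1} + εᵢ` with initial value `x₀ = 0`. -/
noncomputable def arSeq0 (α : ℝ) (f e : ℕ → ℝ) : ℕ → ℝ
  | 0 => 0
  | i + 1 => f (i + 1) + α * arSeq0 α f e i + e (i + 1)

/-- Extension of a vector in `ℝ^{T+1}` to a function on `ℕ` (zero out of range). -/
noncomputable def extendVec {T : ℕ} (v : Fin (T + 1) → ℝ) : ℕ → ℝ := fun j =>
  if h : j < T + 1 then v ⟨j, h⟩ else 0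

/-- The background `f` encoded by the parameter `β = (α₁, μ, Δ₂,…,Δ_T)`:
`f_t = μ + Σ_{j=2}^t Δ_j`. -/
noncomputable def fOf {T : ℕ} (v : Fin (T + 1) → ℝ) : ℕ → ℝ := fun t =>
  extendVec v 1 + ∑ j ∈ Finset.Icc 2 t, extendVec v j

/-- Embedding of a noise vector `z ∈ ℝ^T` as `ε₁,…,ε_T`. -/
noncomputable def noiseOf (T : ℕ) (z : Fin T → ℝ) : ℕ → ℝ := fun n =>
  if h : 1 ≤ n ∧ n ≤ T then z ⟨n - 1, by omega⟩ else 0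

/-- `P_β`: the law on `ℝ^T` of the data `x_{1:T}` generated by the non-stationary AR(1)
model with parameter `β` and i.i.d. standard Gaussian noise. -/
noncomputable def lawOf (T : ℕ) (v : Fin (T + 1) → ℝ) : Measure (Fin T → ℝ) :=
  (Measure.pi fun _ : Fin T => gaussianReal 0 1).map
    fun z => fun t : Fin T => arSeq0 (v 0) (fOf v) (noiseOf T z) ((t : ℕ) + 1)


/-- The parameter space `Θ_T`: `α₁² + μ² ≤ δ_s²`, `Δ` has at most `s(T)−2` nonzero entries,
each of absolute value at most `δ₀(T)`, and at most `s(t)` nonzero entries among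
`Δ₂,…,Δ_t` for each `t ≤ T`. -/
def ThetaT (T : ℕ) (δs : ℝ) (sT : ℕ) (δ₀T : ℝ) (s : ℕ → ℕ) : Set (Fin (T + 1) → ℝ) :=
  {v | (v 0) ^ 2 + (v 1) ^ 2 ≤ δs ^ 2 ∧
    (Finset.univ.filter fun j : Fin (T + 1) => 2 ≤ (j : ℕ) ∧ v j ≠ 0).card ≤ sT - 2 ∧
    (∀ j : Fin (T + 1), 2 ≤ (j : ℕ) → |v j| ≤ δ₀T) ∧
    ∀ t ≤ T, (Finset.univ.filter fun j : Fin (T + 1) =>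
      2 ≤ (j : ℕ) ∧ (j : ℕ) ≤ t ∧ v j ≠ 0).card ≤ s t}

open Classical in
/-- Kullback–Leibler divergence: `KL(P‖Q) = ∫ log(dP/dQ) dP` when `P ≪ Q` (and the
integrand is integrable), and `+∞` otherwise. -/
noncomputable def klDiv {Ω : Type*} [MeasurableSpace Ω] (P Q : Measure Ω) : ℝ≥0∞ :=
  if P ≪ Q ∧ Integrable (fun ω => Real.log (P.rnDeriv Q ω).toReal) P
  then ENNReal.ofReal (∫ ω, Real.log (P.rnDeriv Q ω).toReal ∂P)
  else ∞

theorem aux_pi_density (T : ℕ) :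
    (Measure.pi fun _ : Fin T => gaussianReal 0 1) =
      (volume : Measure (Fin T → ℝ)).withDensity
        (fun z => ENNReal.ofReal (∏ i, gaussianPDFReal 0 1 (z i))) := by
  refine (Measure.pi_eq fun s hs => ?_)
  have hnn : ∀ z : Fin T → ℝ, 0 ≤ ∏ i, gaussianPDFReal 0 1 (z i) := fun z =>
    Finset.prod_nonneg fun i _ => gaussianPDFReal_nonneg _ _ _
  rw [withDensity_apply _ (MeasurableSet.univ_pi hs), volume_pi, Measure.restrict_pi_pi,
    ← ofReal_integral_eq_lintegral_ofReal, integral_fintype_prod_eq_prod,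
    ENNReal.ofReal_prod_of_nonneg]
  · refine Finset.prod_congr rfl fun i _ => ?_
    rw [gaussianReal_apply_eq_integral _ one_ne_zero]
  · intro i _
    exact integral_nonneg fun x => gaussianPDFReal_nonneg _ _ _
  · exact Integrable.fintype_prod fun i => (integrable_gaussianPDFReal 0 1).restrict
  · exact Filter.Eventually.of_forall hnn

noncomputable def auxR (T : ℕ) (v : Fin (T + 1) → ℝ) (x : Fin T → ℝ) : Fin T → ℝ :=
  fun t => x t - v 0 * noiseOf T x t - fOf v ((t : ℕ) + 1)

noncomputable def auxX (T : ℕ) (v : Fin (T + 1) → ℝ) (z : Fin T → ℝ) : Fin T → ℝ :=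
  fun t => arSeq0 (v 0) (fOf v) (noiseOf T z) ((t : ℕ) + 1)

theorem noiseOf_succ {T : ℕ} (z : Fin T → ℝ) (t : Fin T) : noiseOf T z ((t : ℕ) + 1) = z t := by
  have : 1 ≤ (t : ℕ) + 1 ∧ (t : ℕ) + 1 ≤ T := ⟨by omega, t.2⟩
  simp [noiseOf, this]

theorem noiseOf_zero {T : ℕ} (z : Fin T → ℝ) : noiseOf T z 0 = 0 := by
  simp [noiseOf]

theorem noiseOf_auxX {T : ℕ} (v : Fin (T + 1) → ℝ) (z : Fin T → ℝ) (n : ℕ) (hn : n ≤ T) :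
    noiseOf T (auxX T v z) n = arSeq0 (v 0) (fOf v) (noiseOf T z) n := by
  cases n with
  | zero => simp [noiseOf_zero, arSeq0]
  | succ n => exact noiseOf_succ (auxX T v z) ⟨n, hn⟩

theorem auxR_auxX {T : ℕ} (v : Fin (T + 1) → ℝ) (z : Fin T → ℝ) : auxR T v (auxX T v z) = z := by
  ext t
  have := noiseOf_succ z t
  simp only [auxR, noiseOf_auxX v z t t.2.le]
  simp only [auxX, arSeq0]
  linarith

theorem auxX_auxR {T : ℕ} (v : Fin (T + 1) → ℝ) (x : Fin T → ℝ) : auxX T v (auxR T v x) = x := by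
  have key : ∀ n ≤ T, arSeq0 (v 0) (fOf v) (noiseOf T (auxR T v x)) n = noiseOf T x n := by
    intro n
    induction n with
    | zero => intro _; simp [noiseOf_zero, arSeq0]
    | succ n ih =>
      intro hn
      have h1 := noiseOf_succ (auxR T v x) ⟨n, hn⟩
      have h2 := noiseOf_succ x ⟨n, hn⟩
      simp only at h1 h2
      rw [arSeq0, ih (by omega), h1, h2]
      simp only [auxR]
      ring
  ext t
  rw [auxX, key _ t.2, noiseOf_succ]

theorem measurable_noiseOf (T n : ℕ) : Measurable fun z : Fin T → ℝ => noiseOf T z n := by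
  unfold noiseOf
  split_ifs <;> fun_prop

theorem measurable_arSeq0 (T : ℕ) (a : ℝ) (f : ℕ → ℝ) (n : ℕ) :
    Measurable fun z : Fin T → ℝ => arSeq0 a f (noiseOf T z) n := by
  induction n with
  | zero => simp [arSeq0]
  | succ n ih =>
    simp only [arSeq0]
    exact ((ih.const_mul a).const_add _).add (measurable_noiseOf T _)

theorem measurable_auxX (T : ℕ) (v : Fin (T + 1) → ℝ) : Measurable (auxX T v) :=
  measurable_pi_lambda _ fun _ => measurable_arSeq0 _ _ _ _

theorem measurable_auxR (T : ℕ) (v : Fin (T + 1) → ℝ) : Measurable (auxR T v) :=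
  measurable_pi_lambda _ fun t => ((measurable_pi_apply t).sub
    ((measurable_noiseOf T _).const_mul _)).sub_const _

theorem map_auxR (T : ℕ) (v : Fin (T + 1) → ℝ) :
    Measure.map (auxR T v) volume = volume := by
  let M : Matrix (Fin T) (Fin T) ℝ := Matrix.of fun i j =>
    if i = j then 1 else if (j : ℕ) + 1 = i then - v 0 else 0
  have hdet : M.det = 1 := by
    rw [Matrix.det_of_isLowerTriangular]
    · simp [M]
    · intro i j hij
      have hij' : i < j := hij
      have h1 : ¬ i = j := hij'.ne
      have h2 : ¬ (j : ℕ) + 1 = i := by have : (i : ℕ) < j := hij'; omega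
      simp [M, h1, h2]
  have hM : Measure.map (Matrix.toLin' M) volume = volume := by
    rw [Real.map_matrix_volume_pi_eq_smul_volume_pi (by simp [hdet])]
    simp [hdet]
  have hL : ∀ x, Matrix.toLin' M x = fun t : Fin T => x t - v 0 * noiseOf T x t := by
    intro x
    ext t
    simp only [Matrix.toLin'_apply, Matrix.mulVec, dotProduct, M, Matrix.of_apply]
    have : ∀ j : Fin T, (if t = j then (1:ℝ) else if (j : ℕ) + 1 = t then - v 0 else 0) * x j
      = (if t = j then x j else 0) + (if (j : ℕ) + 1 = t then - v 0 * x j else 0) := by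
      intro j
      split_ifs with h1 h2 <;> first | (subst h1; omega) | ring
    simp only [this, Finset.sum_add_distrib, Finset.sum_ite_eq, Finset.mem_univ, if_true]
    rw [sub_eq_add_neg]
    congr 1
    by_cases ht : (t : ℕ) = 0
    · rw [ht, noiseOf_zero]
      simp
    · obtain ⟨n, hn⟩ := Nat.exists_eq_succ_of_ne_zero ht
      have hnT : n < T := by have := t.2; omega
      rw [Finset.sum_eq_single (⟨n, hnT⟩ : Fin T)]
      · have := noiseOf_succ x ⟨n, hnT⟩
        simp only at this
        rw [hn, Nat.succ_eq_add_one, this]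
        simp
      · intro j _ hj
        rw [if_neg]
        intro h
        apply hj
        ext
        simp only
        omega
      · simp
  have hcomp : auxR T v = (fun y => y - fun t : Fin T => fOf v ((t : ℕ) + 1)) ∘ (Matrix.toLin' M) := by
    ext x t
    simp [auxR, hL]
  rw [hcomp, ← Measure.map_map (by fun_prop) ?_, hM]
  · exact (measurePreserving_sub_right volume _).map_eq
  · exact (LinearMap.continuous_of_finiteDimensional _).measurable

theorem map_auxX (T : ℕ) (v : Fin (T + 1) → ℝ) :
    Measure.map (auxX T v) volume = volume := by
  conv_lhs => rw [← map_auxR T v]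
  rw [Measure.map_map (measurable_auxX T v) (measurable_auxR T v)]
  have : auxX T v ∘ auxR T v = id := by ext1 x; exact auxX_auxR v x
  rw [this, Measure.map_id]

noncomputable def auxp (T : ℕ) (v : Fin (T + 1) → ℝ) (x : Fin T → ℝ) : ℝ :=
  ∏ i, gaussianPDFReal 0 1 (auxR T v x i)

theorem auxp_pos {T : ℕ} (v : Fin (T + 1) → ℝ) (x : Fin T → ℝ) : 0 < auxp T v x :=
  Finset.prod_pos fun i _ => gaussianPDFReal_pos _ _ _ one_ne_zero

theorem measurable_auxp (T : ℕ) (v : Fin (T + 1) → ℝ) : Measurable (auxp T v) :=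
  Finset.measurable_fun_prod _ fun i _ => (measurable_gaussianPDFReal 0 1).comp
    ((measurable_pi_apply i).comp (measurable_auxR T v))

theorem lawOf_eq (T : ℕ) (v : Fin (T + 1) → ℝ) :
    lawOf T v = (volume : Measure (Fin T → ℝ)).withDensity
      (fun x => ENNReal.ofReal (auxp T v x)) := by
  change Measure.map (auxX T v) _ = _
  rw [aux_pi_density]
  ext s hs
  have mp : MeasurePreserving (auxX T v) volume volume := ⟨measurable_auxX T v, map_auxX T v⟩
  rw [Measure.map_apply (measurable_auxX T v) hs, withDensity_apply _ hs,
    withDensity_apply _ (measurable_auxX T v hs),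
    ← mp.setLIntegral_comp_preimage hs (measurable_auxp T v).ennreal_ofReal]
  simp only [auxp, auxR_auxX]

theorem lawOf_rel (T : ℕ) (v v' : Fin (T + 1) → ℝ) :
    lawOf T v = (lawOf T v').withDensity
      (fun x => ENNReal.ofReal (auxp T v x / auxp T v' x)) := by
  rw [lawOf_eq T v, lawOf_eq T v', ← withDensity_mul _ (measurable_auxp T v').ennreal_ofReal
    (show Measurable fun x => ENNReal.ofReal (auxp T v x / auxp T v' x) from
      ((measurable_auxp T v).div (measurable_auxp T v')).ennreal_ofReal)]
  congr 1
  ext x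
  simp only [Pi.mul_apply]
  rw [← ENNReal.ofReal_mul (auxp_pos v' x).le, mul_div_cancel₀ _ (auxp_pos v' x).ne']

instance aux_prob (T : ℕ) (v : Fin (T + 1) → ℝ) : IsProbabilityMeasure (lawOf T v) :=
  Measure.isProbabilityMeasure_map (measurable_auxX T v).aemeasurable

theorem log_auxp {T : ℕ} (v : Fin (T + 1) → ℝ) (x : Fin T → ℝ) :
    Real.log (auxp T v x) = ∑ i : Fin T, (Real.log (√(2 * Real.pi))⁻¹ - (auxR T v x i) ^ 2 / 2) := by
  rw [auxp, Real.log_prod (fun i _ => (gaussianPDFReal_pos _ _ _ one_ne_zero).ne')]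
  refine Finset.sum_congr rfl fun i _ => ?_
  rw [gaussianPDFReal, Real.log_mul (by positivity) (Real.exp_pos _).ne', Real.log_exp]
  simp
  ring

theorem klDiv_le_of {T : ℕ} (v v' : Fin (T + 1) → ℝ) (a b : ℝ)
    (h : ∀ z : Fin T → ℝ, |∑ i : Fin T, ((auxR T v' (auxX T v z) i) ^ 2 / 2 - (z i) ^ 2 / 2)| ≤
      a + b * ∑ i, (z i) ^ 2) :
    klDiv (lawOf T v) (lawOf T v') ≤ ENNReal.ofReal (a + b * T) := by
  have hac : lawOf T v ≪ lawOf T v' := by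
    rw [lawOf_rel T v v']
    exact withDensity_absolutelyContinuous _ _
  have hmr : Measurable fun x => Real.log (auxp T v x / auxp T v' x) :=
    ((measurable_auxp T v).div (measurable_auxp T v')).log
  have hrn : (fun x => Real.log ((lawOf T v).rnDeriv (lawOf T v') x).toReal) =ᵐ[lawOf T v]
      fun x => Real.log (auxp T v x / auxp T v' x) := by
    apply hac.ae_eq
    have := Measure.rnDeriv_withDensity (lawOf T v')
      ((measurable_auxp T v).div (measurable_auxp T v')).ennreal_ofReal
    rw [Pi.div_def] at this
    rw [← lawOf_rel T v v'] at this
    filter_upwards [this] with x hx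
    rw [hx, ENNReal.toReal_ofReal (div_pos (auxp_pos v x) (auxp_pos v' x)).le]
  have hL : ∀ z, Real.log (auxp T v (auxX T v z) / auxp T v' (auxX T v z)) =
      ∑ i : Fin T, ((auxR T v' (auxX T v z) i) ^ 2 / 2 - (z i) ^ 2 / 2) := by
    intro z
    rw [Real.log_div (auxp_pos _ _).ne' (auxp_pos _ _).ne', log_auxp, log_auxp,
      ← Finset.sum_sub_distrib, auxR_auxX]
    refine Finset.sum_congr rfl fun i _ => ?_
    ring
  set γ := (Measure.pi fun _ : Fin T => gaussianReal 0 1) with hγ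
  have hsq : ∀ i : Fin T, Integrable (fun z : Fin T → ℝ => (z i) ^ 2) γ ∧
      ∫ z, (z i) ^ 2 ∂γ = 1 := by
    intro i
    have mp : MeasurePreserving (Function.eval i) γ (gaussianReal 0 1) :=
      measurePreserving_eval (fun _ : Fin T => gaussianReal 0 1) i
    have h1 : Integrable (fun x : ℝ => x ^ 2) (gaussianReal 0 1) :=
      (memLp_id_gaussianReal (μ := 0) (v := 1) 2).integrable_sq
    have h2 : ∫ x, x ^ 2 ∂(gaussianReal 0 1) = 1 := by
      have := variance_id_gaussianReal (μ := 0) (v := 1)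
      rw [variance_of_integral_eq_zero aemeasurable_id (by simp [integral_id_gaussianReal])] at this
      simpa using this
    refine ⟨mp.integrable_comp_of_integrable h1, ?_⟩
    rw [← h2, ← mp.map_eq, integral_map mp.measurable.aemeasurable
      (by rw [mp.map_eq]; exact h1.aestronglyMeasurable)]
  have hG : Integrable (fun z : Fin T → ℝ => a + b * ∑ i, (z i) ^ 2) γ :=
    (integrable_const a).add ((integrable_finsetSum _ fun i _ => (hsq i).1).const_mul b)
  have hGi : ∫ z, (a + b * ∑ i, (z i) ^ 2) ∂γ = a + b * T := by
    rw [integral_add (integrable_const a)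
      ((integrable_finsetSum _ fun i _ => (hsq i).1).const_mul b), integral_const_mul,
      integral_finsetSum _ fun i _ => (hsq i).1]
    simp [hsq]
  have hlaw : lawOf T v = Measure.map (auxX T v) γ := rfl
  have hIL : Integrable (fun z => Real.log (auxp T v (auxX T v z) / auxp T v' (auxX T v z))) γ := by
    refine hG.mono' (hmr.comp (measurable_auxX T v)).aestronglyMeasurable ?_
    refine Filter.Eventually.of_forall fun z => ?_
    rw [Real.norm_eq_abs, hL]
    exact h z
  have hI : Integrable (fun x => Real.log (auxp T v x / auxp T v' x)) (lawOf T v) := by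
    rw [hlaw, integrable_map_measure hmr.aestronglyMeasurable (measurable_auxX T v).aemeasurable]
    exact hIL
  rw [klDiv, if_pos ⟨hac, hI.congr hrn.symm⟩, integral_congr_ae hrn, hlaw,
    integral_map (measurable_auxX T v).aemeasurable hmr.aestronglyMeasurable, ← hGi]
  refine ENNReal.ofReal_le_ofReal (integral_mono hIL hG fun z => ?_)
  simp only [hL]
  exact (le_abs_self _).trans (h z)

theorem arSeq0_sum_sq (a δ : ℝ) (ha : |a| ≤ δ) (h1 : δ < 1) (f e : ℕ → ℝ) (n : ℕ) :
    ∑ t ∈ Finset.range n, (arSeq0 a f e t) ^ 2 ≤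
      1 / (1 - δ) ^ 2 * (2 * ∑ t ∈ Finset.range n, (f (t + 1)) ^ 2
        + 2 * ∑ t ∈ Finset.range n, (e (t + 1)) ^ 2) := by
  have hδ0 : 0 ≤ δ := (abs_nonneg a).trans ha
  have hpos : 0 < 1 - δ := by linarith
  have ha2 : a ^ 2 ≤ δ ^ 2 := sq_le_sq' (by linarith [neg_abs_le a]) (by linarith [le_abs_self a])
  have step : ∀ t, (1 - δ) * (arSeq0 a f e (t + 1)) ^ 2 ≤
      (1 - δ) * δ * (arSeq0 a f e t) ^ 2 + (2 * (f (t + 1)) ^ 2 + 2 * (e (t + 1)) ^ 2) := by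
    intro t
    rw [arSeq0]
    generalize arSeq0 a f e t = x
    generalize f (t + 1) = p
    generalize e (t + 1) = q
    have h2 : (1 - δ) * (a * x + (p + q)) ^ 2 ≤ (1 - δ) * δ * x ^ 2 + (p + q) ^ 2 := by
      rcases hδ0.eq_or_lt with h0 | h0
      · have : a = 0 := by
          rw [← h0] at ha
          exact abs_nonpos_iff.1 ha
        subst this
        rw [← h0]
        nlinarith
      · have h3 : a ^ 2 * x ^ 2 ≤ δ ^ 2 * x ^ 2 := mul_le_mul_of_nonneg_right ha2 (sq_nonneg x)
        have h4 : 0 ≤ ((1 - δ) * (a * x) - δ * (p + q)) ^ 2 := sq_nonneg _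
        have h5 : δ * ((1 - δ) * (a * x + (p + q)) ^ 2) ≤
            δ * ((1 - δ) * δ * x ^ 2 + (p + q) ^ 2) := by
          have h6 := mul_le_mul_of_nonneg_left h3 hpos.le
          nlinarith
        exact le_of_mul_le_mul_left h5 h0
    nlinarith [sq_nonneg (p - q)]
  have hs : (1 - δ) * ∑ t ∈ Finset.range n, (arSeq0 a f e (t + 1)) ^ 2 ≤
      (1 - δ) * δ * ∑ t ∈ Finset.range n, (arSeq0 a f e t) ^ 2 +
        (2 * ∑ t ∈ Finset.range n, (f (t + 1)) ^ 2
        + 2 * ∑ t ∈ Finset.range n, (e (t + 1)) ^ 2) := by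
    simp only [Finset.mul_sum, ← Finset.sum_add_distrib]
    exact Finset.sum_le_sum fun t _ => step t
  have hle : ∑ t ∈ Finset.range n, (arSeq0 a f e t) ^ 2 ≤
      ∑ t ∈ Finset.range n, (arSeq0 a f e (t + 1)) ^ 2 := by
    have h1 := Finset.sum_range_succ (fun t => (arSeq0 a f e t) ^ 2) n
    have h2 := Finset.sum_range_succ' (fun t => (arSeq0 a f e t) ^ 2) n
    have h3 : arSeq0 a f e 0 = 0 := rfl
    rw [h3] at h2
    nlinarith [sq_nonneg (arSeq0 a f e n)]
  rw [one_div, inv_mul_eq_div, le_div_iff₀ (by positivity)]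
  nlinarith [mul_le_mul_of_nonneg_left hle hpos.le]

theorem fOf_bound {T : ℕ} (hT : 2 ≤ T) {δs δ₀ : ℝ} (hδ : 0 < δs) (hδ1 : δs < 1) (hδ₀ : 0 ≤ δ₀)
    {s : ℕ → ℕ} {v : Fin (T + 1) → ℝ} (hv : v ∈ ThetaT T δs (s T) δ₀ s) (t : ℕ) (ht : t < T) :
    (fOf v (t + 1)) ^ 2 ≤ 2 + 2 * δ₀ ^ 2 * (if t = 0 then 0 else (s (t + 1) : ℝ) ^ 2) := by
  obtain ⟨h1, -, h3, h4⟩ := hv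
  have hmu : (extendVec v 1) ^ 2 ≤ 1 := by
    have : extendVec v 1 = v 1 := by
      rw [extendVec, dif_pos (by omega)]
      congr 1
      ext
      simp [Fin.val_one', Nat.mod_eq_of_lt (show 1 < T + 1 by omega)]
    rw [this]
    nlinarith [sq_nonneg (v 0)]
  rw [fOf]
  split_ifs with h0
  · subst h0
    simp
    linarith
  · have hb : |∑ j ∈ Finset.Icc 2 (t + 1), extendVec v j| ≤ δ₀ * s (t + 1) := by
      rw [← Finset.sum_filter_ne_zero]
      refine (Finset.abs_sum_le_sum_abs _ _).trans ?_
      refine (Finset.sum_le_card_nsmul _ _ δ₀ ?_).trans ?_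
      · intro j hj
        simp only [Finset.mem_filter, Finset.mem_Icc] at hj
        have hj' : j < T + 1 := by omega
        rw [extendVec, dif_pos hj']
        exact h3 _ hj.1.1
      · rw [nsmul_eq_mul, mul_comm]
        refine mul_le_mul_of_nonneg_left ?_ hδ₀
        rw [Nat.cast_le]
        refine le_trans ?_ (h4 (t + 1) ht)
        rw [← Finset.card_map Fin.valEmbedding]
        refine Finset.card_le_card fun j hj => ?_
        simp only [Finset.mem_filter, Finset.mem_Icc] at hj
        have hj' : j < T + 1 := by omega
        rw [extendVec, dif_pos hj'] at hj
        simp only [Finset.mem_map, Finset.mem_filter, Finset.mem_univ, true_and]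
        exact ⟨⟨j, hj'⟩, ⟨hj.1.1, hj.1.2, hj.2⟩, rfl⟩
    have hb2 : (∑ j ∈ Finset.Icc 2 (t + 1), extendVec v j) ^ 2 ≤ (δ₀ * s (t + 1)) ^ 2 := by
      rw [← sq_abs]
      exact pow_le_pow_left₀ (abs_nonneg _) hb 2
    nlinarith [sq_nonneg (extendVec v 1 - ∑ j ∈ Finset.Icc 2 (t + 1), extendVec v j)]

theorem fOf_sum_bound {T : ℕ} (hT : 2 ≤ T) {δs δ₀ : ℝ} (hδ : 0 < δs) (hδ1 : δs < 1) (hδ₀ : 0 ≤ δ₀)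
    {s : ℕ → ℕ} {v : Fin (T + 1) → ℝ} (hv : v ∈ ThetaT T δs (s T) δ₀ s) :
    ∑ t ∈ Finset.range T, (fOf v (t + 1)) ^ 2 ≤
      2 * T + 2 * δ₀ ^ 2 * ∑ t ∈ Finset.Icc 2 T, (s t : ℝ) ^ 2 := by
  have hw : ∑ t ∈ Finset.range T, (if t = 0 then 0 else (s (t + 1) : ℝ) ^ 2) =
      ∑ t ∈ Finset.Icc 2 T, (s t : ℝ) ^ 2 := by
    obtain ⟨n, rfl⟩ : ∃ n, T = n + 1 := ⟨T - 1, by omega⟩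
    rw [Finset.sum_range_succ']
    simp only [if_true, add_zero, Nat.succ_ne_zero, if_false]
    rw [← Finset.Ico_add_one_right_eq_Icc, Finset.sum_Ico_eq_sum_range]
    refine Finset.sum_congr (by congr 1) fun k _ => ?_
    rw [show k + 1 + 1 = 2 + k by ring]
  refine (Finset.sum_le_sum fun t ht =>
    fOf_bound hT hδ hδ1 hδ₀ hv t (Finset.mem_range.1 ht)).trans ?_
  rw [Finset.sum_add_distrib, ← Finset.mul_sum, hw]
  simp
  linarith

/-- **Lemma 6.** For the non-stationary AR(1) model with i.i.d. standard
Gaussian noise and `x₀ = 0`, there exist constants `C₃, C₄, C₅ > 0` depending only on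
`δ_s ∈ (0,1)` such that for any two parameters `β, β′ ∈ Θ_T`,
`KL(p_β ‖ p_{β′}) ≤ C₃·T + C₄·δ₀(T)·Σ_{t=2}^T s(t) + C₅·δ₀(T)²·Σ_{t=2}^T s(t)²`. -/
theorem stmt_13 (δs : ℝ) (hδs0 : 0 < δs) (hδs1 : δs < 1) :
    ∃ C₃ C₄ C₅ : ℝ, 0 < C₃ ∧ 0 < C₄ ∧ 0 < C₅ ∧
      ∀ T : ℕ, 2 ≤ T → ∀ (s : ℕ → ℕ) (δ₀ : ℝ), 0 ≤ δ₀ →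
      ∀ v v' : Fin (T + 1) → ℝ,
        v ∈ ThetaT T δs (s T) δ₀ s → v' ∈ ThetaT T δs (s T) δ₀ s →
        klDiv (lawOf T v) (lawOf T v') ≤
          ENNReal.ofReal (C₃ * T + C₄ * δ₀ * (∑ t ∈ Finset.Icc 2 T, (s t : ℝ))
            + C₅ * δ₀ ^ 2 * (∑ t ∈ Finset.Icc 2 T, (s t : ℝ) ^ 2)) := by
  have hC : 0 < 1 / (1 - δs) ^ 2 := by
    have : 0 < 1 - δs := by linarith
    positivity
  set C := 1 / (1 - δs) ^ 2 with hCdef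
  refine ⟨16 + 32 * C + (1 / 2 + 16 * C), 1, 16 + 32 * C, by positivity, one_pos, by positivity, ?_⟩
  intro T hT s δ₀ hδ₀ v v' hv hv'
  set S2 := ∑ t ∈ Finset.Icc 2 T, (s t : ℝ) ^ 2 with hS2
  have hS1 : 0 ≤ ∑ t ∈ Finset.Icc 2 T, (s t : ℝ) := Finset.sum_nonneg fun _ _ => by positivity
  have hF := fOf_sum_bound hT hδs0 hδs1 hδ₀ hv
  have hF' := fOf_sum_bound hT hδs0 hδs1 hδ₀ hv'
  have habs : ∀ w : Fin (T + 1) → ℝ, w ∈ ThetaT T δs (s T) δ₀ s → |w 0| ≤ δs := fun w hw =>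
    abs_le_of_sq_le_sq (by nlinarith [hw.1, sq_nonneg (w 1)]) hδs0.le
  have ha := habs v hv
  have ha' := habs v' hv'
  have hd : (v 0 - v' 0) ^ 2 ≤ 4 := by
    rw [abs_le] at ha ha'
    nlinarith
  refine (klDiv_le_of v v' ((8 + 16 * C) * (2 * T + 2 * δ₀ ^ 2 * S2)) (1 / 2 + 16 * C) ?_).trans ?_
  · intro z
    have hx := arSeq0_sum_sq (v 0) δs ha hδs1 (fOf v) (noiseOf T z) T
    rw [← hCdef] at hx
    simp only [Finset.sum_range, noiseOf_succ] at hx hF hF'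
    have hp : ∀ i : Fin T, |(auxR T v' (auxX T v z) i) ^ 2 / 2 - (z i) ^ 2 / 2| ≤
        1 / 2 * (z i) ^ 2 + 4 * (fOf v (i + 1)) ^ 2 + 4 * (fOf v' (i + 1)) ^ 2 +
          8 * (arSeq0 (v 0) (fOf v) (noiseOf T z) i) ^ 2 := by
      intro i
      have hR : auxR T v' (auxX T v z) i = z i + ((fOf v (i + 1) - fOf v' (i + 1)) +
          (v 0 - v' 0) * arSeq0 (v 0) (fOf v) (noiseOf T z) i) := by
        simp only [auxR, noiseOf_auxX v z i i.2.le]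
        simp only [auxX, arSeq0, noiseOf_succ]
        ring
      rw [hR]
      generalize arSeq0 (v 0) (fOf v) (noiseOf T z) i = x
      generalize fOf v (i + 1) = p
      generalize fOf v' (i + 1) = q
      generalize z i = y
      have h1 : ((p - q) + (v 0 - v' 0) * x) ^ 2 ≤ 4 * p ^ 2 + 4 * q ^ 2 + 8 * x ^ 2 := by
        have h2 := mul_le_mul_of_nonneg_right hd (sq_nonneg x)
        nlinarith [sq_nonneg ((p - q) - (v 0 - v' 0) * x), sq_nonneg (p + q)]
      generalize (p - q) + (v 0 - v' 0) * x = d at h1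
      rw [abs_le]
      constructor
      · nlinarith [sq_nonneg (y + d), sq_nonneg d]
      · nlinarith [sq_nonneg (y - d)]
    refine (Finset.abs_sum_le_sum_abs _ _).trans ((Finset.sum_le_sum fun i _ => hp i).trans ?_)
    simp only [Finset.sum_add_distrib, ← Finset.mul_sum]
    have hCF := mul_le_mul_of_nonneg_left hF hC.le
    linarith
  · refine ENNReal.ofReal_le_ofReal ?_
    have := mul_nonneg hδ₀ hS1
    linarith
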